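/- Let f : ℝ^k → ℝ^k be a continuous map such that f(x + v) − f(x) ∈ ℤ^k for all x ∈ ℝ^k and v ∈ ℤ^k, and such that the induced homomorphism on ℤ^k (given by v ↦ f(x+v) − f(x), independent of x) is surjective (e.g., an isomorphism). Then f is surjective. -/

import Mathlib

open MeasureTheory Set Topology

/-- A map on `ι → ℝ` that is invariant under integer translations. -/
def IntPeriodic {ι α : Type*} (u : (ι → ℝ) → α) : Prop :=
  ∀ (x : ι → ℝ) (v : ι → ℤ), u (x + fun i => (v i : ℝ)) = u x

namespace IntPeriodic

variable {ι α : Type*}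

theorem range_eq_image_Icc {u : (ι → ℝ) → α} (hu : IntPeriodic u) :
    range u = u '' Icc 0 1 := by
  refine (Set.range_subset_iff.2 fun x => ?_).antisymm (image_subset_range u _)
  refine ⟨fun i => Int.fract (x i),
    ⟨fun i => Int.fract_nonneg _, fun i => (Int.fract_lt_one _).le⟩, ?_⟩
  rw [← hu _ fun i => ⌊x i⌋]
  congr 1
  ext i
  simp

theorem isCompact_range [TopologicalSpace α] {u : (ι → ℝ) → α} (hu : IntPeriodic u)
    (hc : Continuous u) : IsCompact (range u) := by
  rw [hu.range_eq_image_Icc]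
  exact isCompact_Icc.image hc

theorem fderiv [Fintype ι] {E : Type*} [NormedAddCommGroup E] [NormedSpace ℝ E]
    {u : (ι → ℝ) → E} (hu : IntPeriodic u) : IntPeriodic (fderiv ℝ u) := fun x v => by
  rw [← fderiv_comp_add_right]
  congr 1
  exact funext fun y => hu y v

theorem exists_norm_le {E : Type*} [NormedAddCommGroup E] {u : (ι → ℝ) → E}
    (hu : IntPeriodic u) (hc : Continuous u) : ∃ C : NNReal, ∀ x, ‖u x‖₊ ≤ C := by
  obtain ⟨C, hC⟩ := (hu.isCompact_range hc).isBounded.exists_norm_le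
  exact ⟨C.toNNReal, fun x => NNReal.le_toNNReal_of_coe_le (hC _ (mem_range_self x))⟩

theorem uniformContinuous [Fintype ι] {E : Type*} [NormedAddCommGroup E] {u : (ι → ℝ) → E}
    (hu : IntPeriodic u) (hc : Continuous u) : UniformContinuous u := by
  rw [Metric.uniformContinuous_iff]
  intro ε hε
  obtain ⟨δ, hδ, h⟩ := Metric.mem_uniformity_dist.1 <|
    (isCompact_Icc (a := (0 : ι → ℝ)) (b := 1)).uniformContinuousAt_of_continuousAt u
      (fun a _ => hc.continuousAt) (Metric.dist_mem_uniformity hε)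
  refine ⟨δ, hδ, fun {a b} hab => ?_⟩
  rw [← hu a fun i => -⌊a i⌋, ← hu b fun i => -⌊a i⌋]
  refine h ((dist_add_right _ _ _).trans_lt hab) ⟨fun i => ?_, fun i => ?_⟩
  · simpa using Int.floor_le (a i)
  · simpa [← sub_eq_add_neg] using (Int.fract_lt_one (a i)).le

/-- Continuous periodic maps are uniform limits of smooth periodic maps. -/
theorem exists_contDiff_approx [Fintype ι] {E : Type*} [NormedAddCommGroup E] [NormedSpace ℝ E]
    [CompleteSpace E] {u : (ι → ℝ) → E} (hu : IntPeriodic u) (hc : Continuous u) {ε : ℝ}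
    (hε : 0 < ε) :
    ∃ w : (ι → ℝ) → E, IntPeriodic w ∧ ContDiff ℝ 1 w ∧ ∀ x, dist (w x) (u x) ≤ ε := by
  obtain ⟨δ, hδ, h⟩ := Metric.uniformContinuous_iff.1 (hu.uniformContinuous hc) ε hε
  let b : ContDiffBump (0 : ι → ℝ) := ⟨δ / 2, δ, by positivity, by linarith⟩
  refine ⟨convolution (b.normed volume) u (ContinuousLinearMap.lsmul ℝ ℝ) volume, ?_, ?_, ?_⟩
  · intro x v
    simp only [convolution_def]
    congr 1
    ext t
    rw [add_sub_right_comm, hu]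
  · exact mod_cast b.hasCompactSupport_normed.contDiff_convolution_left (n := 1) _
      b.contDiff_normed hc.locallyIntegrable
  · intro x
    exact b.dist_normed_convolution_le hc.aestronglyMeasurable fun y hy => (h hy).le

end IntPeriodic

/-- An integer-equivariant bijection that is differentiable maps the unit cube onto a set of
volume one. -/
theorem volume_image_unitCube {ι : Type*} [Fintype ι] {F : (ι → ℝ) → (ι → ℝ)}
    (hF : Differentiable ℝ F) (hb : Function.Bijective F)
    (hv : ∀ (x : ι → ℝ) (v : ι → ℤ),
      F (x + fun i => (v i : ℝ)) = F x + fun i => (v i : ℝ)) :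
    volume (F '' univ.pi fun _ => Ico 0 1) = 1 := by
  have hm : MeasurableSet (univ.pi fun _ : ι => Ico (0 : ℝ) 1) :=
    MeasurableSet.univ_pi fun _ => measurableSet_Ico
  have hdom := ZSpan.isAddFundamentalDomain' (Pi.basisFun ℝ ι) volume
  have hF' : ∀ g ∈ Submodule.span ℤ (range (Pi.basisFun ℝ ι)), ∀ x, F (g + x) = g + F x := by
    intro g hg x
    rw [Module.Basis.mem_span_iff_repr_mem] at hg
    choose v hg using hg
    obtain rfl : (fun i => (v i : ℝ)) = g := funext fun i => by simpa using hg i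
    rw [add_comm, hv, add_comm]
  have himg : IsAddFundamentalDomain
      (Submodule.span ℤ (range (Pi.basisFun ℝ ι))).toAddSubgroup
      (F '' univ.pi fun _ => Ico 0 1) volume := by
    refine .mk' (measurable_image_of_fderivWithin hm
      (fun x _ => (hF x).hasFDerivAt.hasFDerivWithinAt) hb.1.injOn).nullMeasurableSet ?_
    intro y
    obtain ⟨x, rfl⟩ := hb.2 y
    have key : ∀ g : (Submodule.span ℤ (range (Pi.basisFun ℝ ι))).toAddSubgroup,
        g +ᵥ F x ∈ F '' (univ.pi fun _ => Ico 0 1) ↔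
          g +ᵥ x ∈ ZSpan.fundamentalDomain (Pi.basisFun ℝ ι) := by
      intro g
      rw [ZSpan.fundamentalDomain_pi_basisFun, AddSubgroup.vadd_def, AddSubgroup.vadd_def,
        vadd_eq_add, vadd_eq_add, ← hF' _ g.2, hb.1.mem_set_image]
    simp only [key]
    exact ZSpan.exist_unique_vadd_mem_fundamentalDomain (Pi.basisFun ℝ ι) x
  have : Countable (Submodule.span ℤ (range (Pi.basisFun ℝ ι))).toAddSubgroup :=
    inferInstanceAs (Countable (Submodule.span ℤ (range (Pi.basisFun ℝ ι))))
  rw [himg.measure_eq hdom, ZSpan.fundamentalDomain_pi_basisFun, Real.volume_pi_Ico]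
  simp

theorem LipschitzWith.bijective_id_add {E : Type*} [NormedAddCommGroup E] [CompleteSpace E]
    {q : E → E} {K : NNReal} (hq : LipschitzWith K q) (hK : K < 1) :
    Function.Bijective fun x => x + q x := by
  constructor
  · intro x y hxy
    by_contra hne
    have h := hq.dist_le_mul x y
    have h0 : 0 < dist x y := dist_pos.2 hne
    have h1 : dist (q x) (q y) = dist x y := by
      rw [dist_comm x y, dist_eq_norm, dist_eq_norm]
      congr 1
      rw [sub_eq_sub_iff_add_eq_add, add_comm (q x)]
      exact hxy
    have : (K : ℝ) < 1 := hK
    nlinarith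
  · intro y
    have hc : ContractingWith K fun x => y - q x :=
      ⟨hK, LipschitzWith.of_dist_le_mul fun a b => by
        simpa only [dist_sub_left] using hq.dist_le_mul a b⟩
    obtain ⟨x, hx, -⟩ := hc.exists_fixedPoint 0 (edist_ne_top _ _)
    exact ⟨x, sub_eq_iff_eq_add.1 hx |>.symm⟩

theorem integral_det_of_bijective {ι : Type*} [Fintype ι] {F : (ι → ℝ) → (ι → ℝ)}
    (hF : ContDiff ℝ 1 F) (hb : Function.Bijective F)
    (hv : ∀ (x : ι → ℝ) (v : ι → ℤ),
      F (x + fun i => (v i : ℝ)) = F x + fun i => (v i : ℝ))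
    (hpos : ∀ x, 0 ≤ (fderiv ℝ F x).det) :
    ∫ x in univ.pi fun _ => Ico (0 : ℝ) 1, (fderiv ℝ F x).det = 1 := by
  have hd := hF.differentiable one_ne_zero
  have hm : MeasurableSet (univ.pi fun _ : ι => Ico (0 : ℝ) 1) :=
    MeasurableSet.univ_pi fun _ => measurableSet_Ico
  have h := lintegral_abs_det_fderiv_eq_addHaar_image volume hm
    (fun x _ => (hd x).hasFDerivAt.hasFDerivWithinAt) hb.1.injOn
  simp only [abs_of_nonneg (hpos _), volume_image_unitCube hd hb hv] at h
  rw [integral_eq_lintegral_of_nonneg_ae (.of_forall hpos)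
    (ContinuousLinearMap.continuous_det.comp
      (hF.continuous_fderiv one_ne_zero)).aestronglyMeasurable, h, ENNReal.toReal_one]

/-- The determinant of `1 + A` is a fixed linear combination of the determinants of `1 + t j • A`
for sufficiently many distinct parameters `t j`. -/
theorem exists_det_one_add_eq_sum {ι : Type*} [Fintype ι] {t : ℕ → ℝ}
    (ht : Function.Injective t) :
    ∃ c : ℕ → ℝ, ∀ A : (ι → ℝ) →L[ℝ] (ι → ℝ),
      (1 + A).det = ∑ j ∈ Finset.range (Fintype.card ι + 1), c j * (1 + t j • A).det := by
  classical
  refine ⟨fun j => (Lagrange.basis (Finset.range (Fintype.card ι + 1)) t j).eval 1, fun A => ?_⟩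
  set M := LinearMap.toMatrix' (A : (ι → ℝ) →ₗ[ℝ] (ι → ℝ))
  set P := ((Polynomial.X : Polynomial ℝ) • M.map Polynomial.C +
    (1 : Matrix ι ι ℝ).map Polynomial.C).det
  have heval : ∀ s : ℝ, P.eval s = (1 + s • A).det := by
    intro s
    rw [ContinuousLinearMap.det, ← LinearMap.det_toMatrix']
    simp only [P, M]
    rw [← Polynomial.coe_evalRingHom, RingHom.map_det]
    congr 1
    ext i j
    by_cases hij : i = j <;> simp [hij, LinearMap.toMatrix'_apply, add_comm, mul_comm s]
  have hP : P = Lagrange.interpolate (Finset.range (Fintype.card ι + 1)) t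
      fun j => P.eval (t j) := by
    refine Lagrange.eq_interpolate ht.injOn ?_
    rw [Finset.card_range]
    exact Polynomial.degree_le_natDegree.trans_lt
      (Nat.cast_lt.2 (Nat.lt_succ_of_le (Polynomial.natDegree_det_X_add_C_le _ _)))
  have h1 := heval 1
  rw [one_smul] at h1
  rw [← h1, congrArg (Polynomial.eval 1) hP, Lagrange.interpolate_apply, Polynomial.eval_finsetSum]
  refine Finset.sum_congr rfl fun j _ => ?_
  rw [Polynomial.eval_mul, Polynomial.eval_C, heval, mul_comm]

/-- A `C¹` map of the torus homotopic to the identity has degree one. -/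
theorem IntPeriodic.integral_det_one_add {ι : Type*} [Fintype ι] {p : (ι → ℝ) → (ι → ℝ)}
    (hp : IntPeriodic p) (hd : ContDiff ℝ 1 p) :
    ∫ x in univ.pi fun _ => Ico (0 : ℝ) 1, (1 + _root_.fderiv ℝ p x).det = 1 := by
  obtain ⟨C, hC⟩ := hp.fderiv.exists_norm_le (hd.continuous_fderiv one_ne_zero)
  have hdiff := hd.differentiable one_ne_zero
  obtain ⟨ε, hε, hdet⟩ : ∃ ε > 0, ∀ A : (ι → ℝ) →L[ℝ] (ι → ℝ), ‖A‖ < ε → 0 < (1 + A).det := by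
    have hcont : Continuous fun A : (ι → ℝ) →L[ℝ] (ι → ℝ) => (1 + A).det :=
      ContinuousLinearMap.continuous_det.comp (continuous_const.add continuous_id)
    have h0 : (0 : (ι → ℝ) →L[ℝ] (ι → ℝ)) ∈ {A | 0 < (1 + A).det} := by
      simp [ContinuousLinearMap.det]
    obtain ⟨ε, hε, h⟩ := Metric.isOpen_iff.1 (isOpen_lt continuous_const hcont) _ h0
    exact ⟨ε, hε, fun A hA => h (mem_ball_zero_iff.2 hA)⟩
  have hsmall : ∀ s : ℝ, 0 ≤ s → s * C < 1 → s * C < ε →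
      ∫ x in univ.pi fun _ => Ico (0 : ℝ) 1, (1 + s • _root_.fderiv ℝ p x).det = 1 := by
    intro s hs h1 h2
    have hfd : ∀ x, _root_.fderiv ℝ (fun x => x + (s • p) x) x =
        1 + s • _root_.fderiv ℝ p x := by
      intro x
      exact ((hasFDerivAt_id x).add ((hdiff x).hasFDerivAt.const_smul s)).fderiv
    have hlip : LipschitzWith (s.toNNReal * C) (s • p) :=
      LipschitzWith.of_dist_le_mul fun x y => by
        have := (lipschitzWith_of_nnnorm_fderiv_le hdiff hC).dist_le_mul x y
        simp only [Pi.smul_apply, dist_smul₀, Real.norm_of_nonneg hs, NNReal.coe_mul,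
          Real.coe_toNNReal s hs, mul_assoc]
        gcongr
    have hb := hlip.bijective_id_add (by
      rw [← NNReal.coe_lt_coe]
      simpa [Real.coe_toNNReal s hs] using h1)
    simp only [← hfd]
    refine integral_det_of_bijective (contDiff_id.add (hd.const_smul s)) hb ?_ ?_
    · intro x v
      simp only [Pi.smul_apply, hp x v]
      abel
    · intro x
      rw [hfd]
      refine (hdet _ ?_).le
      rw [norm_smul, Real.norm_of_nonneg hs]
      exact (mul_le_mul_of_nonneg_left (NNReal.coe_le_coe.2 (hC x)) hs).trans_lt h2
  set η : ℝ := min 1 ε / (C + 1)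
  have hη : 0 < η := by positivity
  have hηC : η * C < min 1 ε := by
    have : η * (C + 1) = min 1 ε := div_mul_cancel₀ _ (by positivity)
    linarith
  set t : ℕ → ℝ := fun j => η / (j + 1)
  have ht : Function.Injective t := by
    intro a b hab
    have ha : (a : ℝ) + 1 ≠ 0 := by positivity
    have hb : (b : ℝ) + 1 ≠ 0 := by positivity
    simp only [t, div_eq_div_iff ha hb, mul_right_inj' hη.ne'] at hab
    exact_mod_cast (add_right_cancel hab).symm
  have htle : ∀ j, t j * C < min 1 ε := fun j =>
    (mul_le_mul_of_nonneg_right (div_le_self hη.le (by simp)) C.2).trans_lt hηC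
  obtain ⟨c, hc⟩ := exists_det_one_add_eq_sum (ι := ι) ht
  have hint : ∀ s : ℝ, IntegrableOn (fun x => (1 + s • _root_.fderiv ℝ p x).det)
      (univ.pi fun _ => Ico (0 : ℝ) 1) := by
    intro s
    have : Continuous fun x => (1 + s • _root_.fderiv ℝ p x).det :=
      ContinuousLinearMap.continuous_det.comp
        (continuous_const.add ((hd.continuous_fderiv one_ne_zero).const_smul s))
    refine (this.continuousOn.integrableOn_compact (isCompact_Icc (a := 0) (b := 1))).mono_set ?_
    rw [← pi_univ_Icc]
    exact Set.pi_mono fun i _ => Ico_subset_Icc_self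
  have hone : (∑ j ∈ Finset.range (Fintype.card ι + 1), c j) = 1 := by
    have := hc 0
    simpa [ContinuousLinearMap.det] using this.symm
  rw [integral_congr_ae (.of_forall fun x => hc (_root_.fderiv ℝ p x)),
    integral_finsetSum _ fun j _ => (hint _).const_mul _]
  simp_rw [integral_const_mul]
  refine Eq.trans (Finset.sum_congr rfl fun j _ => ?_) hone
  rw [hsmall _ (by positivity) ((htle j).trans_le (min_le_left _ _))
    ((htle j).trans_le (min_le_right _ _)), mul_one]

/-- A `C¹` degree-one circle map that is stationary away from the base point. -/
theorem exists_contDiff_step {δ : ℝ} (hδ : 0 < δ) :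
    ∃ g : ℝ → ℝ, ContDiff ℝ 1 g ∧ (∀ (x : ℝ) (n : ℤ), g (x + n) = g x + n) ∧
      ∀ x : ℝ, δ ≤ ‖(x : UnitAddCircle)‖ → deriv g x = 0 := by
  set h : ℝ → ℝ := fun x => max 0 (δ - ‖(x : UnitAddCircle)‖)
  have hc : Continuous h := continuous_const.max
    (continuous_const.sub (continuous_norm.comp (AddCircle.continuous_mk' 1)))
  have hper : Function.Periodic h 1 := fun x => by simp only [h, AddCircle.coe_add_period]
  have hnn : ∀ x, 0 ≤ h x := fun x => le_max_left _ _
  set I := ∫ x in (0 : ℝ)..1, h x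
  have hI : 0 < I := by
    refine intervalIntegral.integral_pos one_pos hc.continuousOn (fun x _ => hnn x)
      ⟨0, left_mem_Icc.2 zero_le_one, ?_⟩
    simp [h, hδ]
  have hderiv : ∀ x, HasDerivAt (fun y => (∫ s in (0 : ℝ)..y, h s) / I) (h x / I) x := fun x =>
    (hc.integral_hasStrictDerivAt 0 x).hasDerivAt.div_const I
  refine ⟨fun y => (∫ s in (0 : ℝ)..y, h s) / I, ?_, ?_, ?_⟩
  · rw [contDiff_one_iff_deriv]
    refine ⟨fun x => (hderiv x).differentiableAt, ?_⟩
    rw [funext fun x => (hderiv x).deriv]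
    exact hc.div_const I
  · intro x n
    have h1 := hper.intervalIntegral_add_zsmul_eq n x (fun a b => hc.intervalIntegrable a b)
    have h2 : (∫ s in (0 : ℝ)..x, h s) + ∫ s in x..(x + n), h s = ∫ s in (0 : ℝ)..(x + n), h s :=
      intervalIntegral.integral_add_adjacent_intervals (hc.intervalIntegrable _ _)
        (hc.intervalIntegrable _ _)
    simp only [zsmul_eq_mul, mul_one] at h1
    rw [hper.intervalIntegral_add_eq x 0, zero_add] at h1
    change (∫ s in (0 : ℝ)..(x + n), h s) / I = (∫ s in (0 : ℝ)..x, h s) / I + n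
    rw [← h2, h1, add_div, mul_div_cancel_right₀ _ hI.ne']
  · intro x hx
    rw [(hderiv x).deriv]
    simp [h, hx]

/-- A continuous self-map of `ι → ℝ` commuting with integer translations has a zero. -/
theorem exists_eq_zero_of_intPeriodic {ι : Type*} [Fintype ι] {p : (ι → ℝ) → (ι → ℝ)}
    (hp : IntPeriodic p) (hc : Continuous p) : ∃ x, x + p x = 0 := by
  by_contra! hne
  let N : (ι → ℝ) → (ι → UnitAddCircle) := fun x i => ((x i : ℝ) : UnitAddCircle)
  have hNc : Continuous N := continuous_pi fun i =>
    (AddCircle.continuous_mk' 1).comp (continuous_apply i)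
  obtain ⟨δ, hδ, hN⟩ : ∃ δ > 0, ∀ x, 2 * δ ≤ ‖N (x + p x)‖ := by
    have hper : IntPeriodic fun x => ‖N (x + p x)‖ := fun x v => by
      have : N (x + (fun i => (v i : ℝ)) + p (x + fun i => (v i : ℝ))) = N (x + p x) := by
        ext i
        have hv : ((v i : ℝ) : UnitAddCircle) = 0 :=
          (AddCircle.coe_eq_zero_iff 1).2 ⟨v i, by simp⟩
        simp only [N, hp x v, Pi.add_apply, AddCircle.coe_add, hv, add_zero]
      simp only [this]
    obtain ⟨m, ⟨x₀, rfl⟩, hm⟩ := (hper.isCompact_range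
      (hNc.comp (continuous_id.add hc)).norm).exists_isLeast (range_nonempty _)
    refine ⟨‖N (x₀ + p x₀)‖ / 2, half_pos (norm_pos_iff.2 fun h0 => ?_), fun x => ?_⟩
    · have h1 : ∀ i, ∃ n : ℤ, n • (1 : ℝ) = (x₀ + p x₀) i := fun i =>
        (AddCircle.coe_eq_zero_iff 1).1 (congrFun h0 i)
      choose v hv using h1
      refine hne (x₀ + fun i => ((-v i : ℤ) : ℝ)) ?_
      rw [hp x₀ fun i => -v i]
      ext i
      have := hv i
      simp only [zsmul_eq_mul, mul_one, Pi.add_apply] at this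
      simp [this]
    · rw [mul_div_cancel₀ _ two_ne_zero]
      exact hm (mem_range_self x)
  obtain ⟨q, hq, hqd, hqp⟩ := hp.exists_contDiff_approx hc hδ
  obtain ⟨g, hg, hgn, hg0⟩ := exists_contDiff_step hδ
  have hcoord : ∀ x, ∃ i, δ ≤ ‖(((x + q x) i : ℝ) : UnitAddCircle)‖ := by
    intro x
    by_contra! hlt
    have h1 : ‖N (x + q x)‖ < δ := (pi_norm_lt_iff hδ).2 hlt
    have h2 : ‖N (x + p x) - N (x + q x)‖ ≤ δ := by
      refine (pi_norm_le_iff_of_nonneg hδ.le).2 fun i => ?_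
      have : (N (x + p x) - N (x + q x)) i = ((p x i - q x i : ℝ) : UnitAddCircle) := by
        simp [N]
      rw [this]
      refine (QuotientAddGroup.norm_mk_le_norm).trans ?_
      have := (dist_le_pi_dist (q x) (p x) i).trans (hqp x)
      rwa [dist_comm, dist_eq_norm] at this
    have h3 := norm_le_norm_add_norm_sub' (N (x + p x)) (N (x + q x))
    linarith [hN x]
  let r : (ι → ℝ) → (ι → ℝ) := fun x i => g ((x + q x) i) - x i
  have hxq : ∀ i, ContDiff ℝ 1 fun x => (x + q x) i := fun i =>
    contDiff_pi.1 (contDiff_id.add hqd) i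
  have hr : ContDiff ℝ 1 r := contDiff_pi.2 fun i => (hg.comp (hxq i)).sub (contDiff_apply ℝ ℝ i)
  have hrper : IntPeriodic r := fun x v => by
    ext i
    simp only [r, hq x v, Pi.add_apply]
    rw [add_right_comm, hgn]
    ring
  have hint := hrper.integral_det_one_add hr
  have hzero : ∀ x, (1 + fderiv ℝ r x).det = 0 := by
    intro x
    obtain ⟨i, hi⟩ := hcoord x
    have hri : HasFDerivAt (fun y => r y i)
        (-ContinuousLinearMap.proj (R := ℝ) (φ := fun _ : ι => ℝ) i) x := by
      have h1 := ((hg.differentiable one_ne_zero _).hasDerivAt.comp_hasFDerivAt x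
        ((hxq i).differentiable one_ne_zero x).hasFDerivAt).sub (hasFDerivAt_apply i x)
      rw [hg0 _ hi, zero_smul, zero_sub] at h1
      exact h1
    have hri' : ∀ w, fderiv ℝ r x w i = -w i := fun w => by
      have h2 := hasFDerivAt_pi'.1 (hr.differentiable one_ne_zero x).hasFDerivAt i
      exact congrArg (fun L : (ι → ℝ) →L[ℝ] ℝ => L w) (h2.unique hri)
    by_contra hdet
    classical
    have hs := ((LinearMap.isUnit_iff_isUnit_det _).2 (isUnit_iff_ne_zero.2 hdet))
    obtain ⟨w, hw⟩ := ((Module.End.isUnit_iff _).1 hs).2 (Pi.single i 1)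
    have := congrFun hw i
    simp [hri'] at this
  simp [hzero] at hint

/-- A continuous map `f : ℝ^k → ℝ^k` with `f(x+v) − f(x) ∈ ℤ^k` for all
`v ∈ ℤ^k`, whose induced homomorphism `φ` on `ℤ^k` (`f(x+v) − f(x) = φ v`, independent
of `x`) is surjective, must itself be surjective. -/
theorem stmt9 (k : ℕ) (f : (Fin k → ℝ) → (Fin k → ℝ)) (hf : Continuous f)
    (φ : (Fin k → ℤ) →+ (Fin k → ℤ)) (hφ : Function.Surjective φ)
    (hequiv : ∀ (x : Fin k → ℝ) (v : Fin k → ℤ),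
      f (x + fun i => (v i : ℝ)) - f x = fun i => ((φ v i : ℤ) : ℝ)) :
    Function.Surjective f := by
  have hinj := OrzechProperty.injective_of_surjective_endomorphism φ.toIntLinearMap hφ
  let e := LinearEquiv.ofBijective φ.toIntLinearMap ⟨hinj, hφ⟩
  set A := LinearMap.toMatrix' (e : (Fin k → ℤ) →ₗ[ℤ] (Fin k → ℤ))
  set B := LinearMap.toMatrix' (e.symm : (Fin k → ℤ) →ₗ[ℤ] (Fin k → ℤ))
  have hAB : A * B = 1 := by rw [← LinearMap.toMatrix'_comp]; simp
  have hBφ : ∀ v, B.mulVec (φ v) = v := fun v => by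
    rw [LinearMap.toMatrix'_mulVec]
    exact e.symm_apply_apply v
  set AR : Matrix (Fin k) (Fin k) ℝ := A.map (Int.castRingHom ℝ)
  set BR : Matrix (Fin k) (Fin k) ℝ := B.map (Int.castRingHom ℝ)
  have hABR : AR * BR = 1 := by rw [← Matrix.map_mul, hAB]; simp
  have hBRφ : ∀ v, BR.mulVec (fun i => (φ v i : ℝ)) = fun i => (v i : ℝ) := fun v => by
    ext i
    have := RingHom.map_mulVec (Int.castRingHom ℝ) B (φ v) i
    rw [hBφ] at this
    exact this.symm
  intro y
  obtain ⟨x, hx⟩ := exists_eq_zero_of_intPeriodic (p := fun x => BR.mulVec (f x - y) - x)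
    (fun x v => by
      simp only
      rw [← sub_add_cancel (f (x + _)) (f x), hequiv, add_sub_assoc, Matrix.mulVec_add, hBRφ]
      abel)
    ((Continuous.matrix_mulVec continuous_const (hf.sub continuous_const)).sub continuous_id)
  refine ⟨x, sub_eq_zero.1 ?_⟩
  rw [add_sub_cancel] at hx
  rw [← Matrix.one_mulVec (f x - y), ← hABR, ← Matrix.mulVec_mulVec, hx, Matrix.mulVec_zero]
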